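/- For the sequence of subgroups Hₙ built from U_D as in Setting A, for every n ≥ 1 and every integer s: the matrix [[1, s],[0, 1]] belongs to the Veech group Γ(Hₙ) if and only if 3n divides s. -/

import Mathlib

/-- The free group on two generators. -/
abbrev F2 := FreeGroup (Fin 2)

/-- The generator `x` of `F₂`. -/
def xg : F2 := FreeGroup.of 0

/-- The generator `y` of `F₂`. -/
def yg : F2 := FreeGroup.of 1

/-- The exponent sum of the `i`-th generator, i.e. the `i`-th coordinate of the image in the
abelianization `ℤ²` of `F₂`. -/
def expSum (i : Fin 2) : F2 →* Multiplicative ℤ :=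
  FreeGroup.lift fun j => Multiplicative.ofAdd (if j = i then (1 : ℤ) else 0)

/-- The matrix in `GL₂(ℤ)` induced by an automorphism `γ` of `F₂` on the abelianization
`F₂^ab ≅ ℤ²` (with basis the images of `x` and `y`); i.e. `β̂(γ)`. -/
def autMat (γ : F2 ≃* F2) : Matrix (Fin 2) (Fin 2) ℤ :=
  Matrix.of fun i j => Multiplicative.toAdd (expSum i (γ (FreeGroup.of j)))

abbrev SL2Z := Matrix.SpecialLinearGroup (Fin 2) ℤ

/-- `Stab(V) = {γ ∈ Aut⁺(F₂) : γ(V) = V}`. -/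
def StabSet (V : Subgroup F2) : Set (F2 ≃* F2) :=
  { γ | (autMat γ).det = 1 ∧ Subgroup.map γ.toMonoidHom V = V }

/-- The Veech group `Γ(V) = β̂(Stab(V)) ⊆ SL₂(ℤ)` of a subgroup `V` of `F₂`. -/
def VeechGroup (V : Subgroup F2) : Set SL2Z :=
  { A | ∃ γ : F2 ≃* F2, γ ∈ StabSet V ∧ (A : Matrix (Fin 2) (Fin 2) ℤ) = autMat γ }

/-- A set of elements of `SL₂(ℤ)` is a congruence group if it contains the principal congruence
subgroup `Γ(n)` for some `n ≥ 1`. -/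
def IsCongruenceSet (S : Set SL2Z) : Prop :=
  ∃ n : ℕ, 1 ≤ n ∧ (CongruenceSubgroup.Gamma n : Set SL2Z) ⊆ S

/-- The subgroup of `Multiplicative ℤ` of elements divisible by `n`. -/
def divSub (n : ℤ) : Subgroup (Multiplicative ℤ) where
  carrier := {d | n ∣ Multiplicative.toAdd d}
  one_mem' := dvd_zero n
  mul_mem' := fun ha hb => dvd_add ha hb
  inv_mem' := fun ha => dvd_neg.mpr ha

/-- The subgroup `Hₙ = {u ∈ U : n ∣ α(u)}` of `F₂` (for `n = 0` this is `ker α = H₀`). -/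
def Hgrp {U : Subgroup F2} (α : U →* Multiplicative ℤ) (n : ℕ) : Subgroup F2 :=
  Subgroup.map U.subtype (Subgroup.comap α (divSub (n : ℤ)))

/-- The subgroup `U_L` of `F₂` corresponding to the origami `L(2,3)`. -/
def UL : Subgroup F2 :=
  Subgroup.closure {xg ^ 3, xg * yg * xg⁻¹, xg ^ 2 * yg * (xg ^ 2)⁻¹, yg * xg * yg⁻¹, yg ^ 2}

/-- The subgroup `U_D` of `F₂` corresponding to the origami `D`. -/
def UD : Subgroup F2 :=
  Subgroup.closure {xg ^ 3, xg * yg * (xg ^ 2)⁻¹, xg ^ 2 * yg * xg⁻¹, yg * xg * yg⁻¹,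
    yg ^ 2 * xg * (yg ^ 2)⁻¹, yg ^ 3}

namespace FreeGroup

variable {α : Type*} [DecidableEq α]

/-- The length of the longest common initial segment of two lists. -/
def lcpLength : List (α × Bool) → List (α × Bool) → ℕ
  | a :: L, b :: M => if a = b then lcpLength L M + 1 else 0
  | _, _ => 0

theorem lcpLength_comm (L M : List (α × Bool)) : lcpLength L M = lcpLength M L := by
  induction L generalizing M with
  | nil => cases M <;> simp [lcpLength]
  | cons a L ih =>
    cases M with
    | nil => simp [lcpLength]
    | cons b M => simp only [lcpLength, ih M, eq_comm (a := a)]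

theorem min_lcpLength_le (L M N : List (α × Bool)) :
    min (lcpLength L M) (lcpLength M N) ≤ lcpLength L N := by
  induction L generalizing M N with
  | nil => simp [lcpLength]
  | cons a L ih =>
    cases M with
    | nil => simp [lcpLength]
    | cons b M =>
      cases N with
      | nil => simp [lcpLength]
      | cons c N =>
        have := ih M N
        simp only [lcpLength]
        split_ifs <;> simp_all

theorem exists_eq_append_of_lcpLength (L M : List (α × Bool)) :
    ∃ P L' M', P.length = lcpLength L M ∧ L = P ++ L' ∧ M = P ++ M' := by
  induction L generalizing M with
  | nil => exact ⟨[], [], M, by simp [lcpLength]⟩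
  | cons a L ih =>
    cases M with
    | nil => exact ⟨[], a :: L, [], by simp [lcpLength]⟩
    | cons b M =>
      by_cases h : a = b
      · obtain ⟨P, L', M', h1, h2, h3⟩ := ih M
        exact ⟨a :: P, L', M', by simp [lcpLength, h, h1], by simp [← h2], by simp [h, ← h3]⟩
      · exact ⟨[], a :: L, b :: M, by simp [lcpLength, h]⟩

theorem norm_mk_inv_mul_mk {L M : List (α × Bool)} (hL : IsReduced L) (hM : IsReduced M) :
    norm ((mk L)⁻¹ * mk M) + 2 * lcpLength L M = L.length + M.length := by
  induction L generalizing M with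
  | nil =>
    rw [← one_eq_mk, inv_one, one_mul, norm, toWord_mk, hM.reduce_eq]
    simp [lcpLength]
  | cons a L ih =>
    have hinv : IsReduced (invRev (a :: L)) := by
      rw [isReduced_iff_reduce_eq, reduce_invRev, hL.reduce_eq]
    cases M with
    | nil =>
      rw [← one_eq_mk, mul_one, norm_inv_eq, norm, toWord_mk, hL.reduce_eq]
      simp [lcpLength]
    | cons b M =>
      by_cases h : a = b
      · subst h
        have key : (mk (a :: L))⁻¹ * mk (a :: M) = (mk L)⁻¹ * mk M := by
          rw [← List.singleton_append (l := L), ← List.singleton_append (l := M), ← mul_mk,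
            ← mul_mk]
          group
        have := ih (M := M) (List.IsChain.tail hL) (List.IsChain.tail hM)
        rw [key]
        simp only [lcpLength, if_true, List.length_cons]
        omega
      · have hred : IsReduced (invRev (a :: L) ++ b :: M) := by
          rw [IsReduced, List.isChain_append]
          refine ⟨hinv, hM, ?_⟩
          intro x hx y hy
          simp only [invRev, List.map_cons, List.reverse_cons, List.getLast?_append,
            List.getLast?_singleton, Option.some_or, Option.mem_def, Option.some.injEq] at hx
          simp only [List.head?_cons, Option.mem_def, Option.some.injEq] at hy
          subst hx hy
          intro h1
          by_contra h2
          apply h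
          ext1
          · exact h1
          · revert h2
            cases a.2 <;> cases b.2 <;> simp
        rw [inv_mk, mul_mk, norm, toWord_mk, hred.reduce_eq]
        simp [lcpLength, h]

/-- The length of the longest common initial segment of the reduced words of two elements. -/
def lcpNorm (a b : FreeGroup α) : ℕ := lcpLength a.toWord b.toWord

theorem lcpNorm_comm (a b : FreeGroup α) : lcpNorm a b = lcpNorm b a := lcpLength_comm _ _

theorem min_lcpNorm_le (a b c : FreeGroup α) : min (lcpNorm a b) (lcpNorm b c) ≤ lcpNorm a c :=
  min_lcpLength_le _ _ _

theorem norm_inv_mul (a b : FreeGroup α) :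
    norm (a⁻¹ * b) + 2 * lcpNorm a b = norm a + norm b := by
  have := norm_mk_inv_mul_mk (isReduced_toWord (x := a)) (isReduced_toWord (x := b))
  rwa [mk_toWord, mk_toWord] at this

theorem norm_mul (a b : FreeGroup α) :
    norm (a * b) + 2 * lcpNorm a⁻¹ b = norm a + norm b := by
  simpa using norm_inv_mul a⁻¹ b

theorem norm_lt_norm_mul_self {a : FreeGroup α} (ha : a ≠ 1) : norm a < norm (a * a) := by
  have hr := isReduced_toWord (x := a)
  have h1 := reduceCyclically.reduce_flatten_replicate_succ hr 1
  have h2 := reduceCyclically.conj_conjugator_reduceCyclically a.toWord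
  have h3 : reduceCyclically a.toWord ≠ [] := by
    intro h
    apply ha
    rw [h, List.append_nil] at h2
    rw [← mk_toWord (x := a), ← h2, ← mul_mk, ← inv_mk, mul_inv_cancel]
  have h4 := congrArg List.length h1
  have h5 := congrArg List.length h2
  have h6 := List.length_pos_iff.mpr h3
  rw [norm, norm, toWord_mul]
  simp [List.replicate_succ] at h4 h5
  omega

theorem two_mul_lcpNorm_inv_self_lt {a : FreeGroup α} (ha : a ≠ 1) :
    2 * lcpNorm a⁻¹ a < norm a := by
  have h1 := norm_mul a a
  have h2 := norm_lt_norm_mul_self ha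
  omega

/-- The lower bound on lengths of products of a Nielsen reduced family. -/
theorem length_add_lcpNorm_le (φ : FreeGroup α →* FreeGroup α)
    (h : ∀ a b c : α × Bool, b ≠ a → c ≠ (a.1, !a.2) →
      lcpNorm (φ (mk [a])) (φ (mk [b])) + lcpNorm (φ (mk [a]))⁻¹ (φ (mk [c])) <
        norm (φ (mk [a]))) :
    ∀ (L : List (α × Bool)) (a : α × Bool), IsReduced (a :: L) → ∀ b ≠ a,
      lcpNorm (φ (mk [b])) (φ (mk (a :: L))) ≤ lcpNorm (φ (mk [a])) (φ (mk [b])) ∧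
      L.length + 1 + lcpNorm (φ (mk [a])) (φ (mk [b])) ≤ norm (φ (mk (a :: L))) := by
  intro L
  induction L with
  | nil =>
    intro a _ b hb
    refine ⟨(lcpNorm_comm _ _).le, ?_⟩
    have := h a b a hb (by intro h; simpa using congrArg Prod.snd h)
    simp only [List.length_nil]
    omega
  | cons c L ih =>
    intro a hr b hb
    have hr' : IsReduced (c :: L) := List.IsChain.tail hr
    have hac : c ≠ (a.1, !a.2) := by
      rintro rfl
      simp at hr
    have hinv : φ (mk [(a.1, !a.2)]) = (φ (mk [a]))⁻¹ := by
      rw [← _root_.map_inv, inv_mk]; rfl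
    obtain ⟨i1, i2⟩ := ih c hr' _ hac.symm
    rw [hinv] at i1 i2
    rw [lcpNorm_comm] at i2
    rw [lcpNorm_comm (φ (mk [c]))] at i1
    have hN := h a b c hb hac
    have hmul : φ (mk (a :: c :: L)) = φ (mk [a]) * φ (mk (c :: L)) := by
      rw [← _root_.map_mul, mul_mk]; rfl
    have e1 := norm_mul (φ (mk [a])) (φ (mk (c :: L)))
    have e2 := norm_inv_mul (φ (mk [a])) (φ (mk (a :: c :: L)))
    have e3 := min_lcpNorm_le (φ (mk [a])) (φ (mk (a :: c :: L))) (φ (mk [b]))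
    rw [hmul, inv_mul_cancel_left] at e2
    rw [hmul] at e3 ⊢
    rw [lcpNorm_comm (φ (mk [b]))]
    simp only [List.length_cons]
    constructor
    · rcases min_le_iff.mp e3 with h | h <;> omega
    · omega

end FreeGroup

/-- A pair whose length drops neither under an elementary Nielsen move nor under a conjugated one
is Nielsen reduced. -/
theorem nielsen_reduced (e : Fin 2 × Bool → F2) (hinv : ∀ i b, e (i, !b) = (e (i, b))⁻¹)
    (hne : ∀ a, e a ≠ 1) (h1 : ∀ a b, a.1 ≠ b.1 → (e b).norm ≤ (e a * e b).norm)
    (h2 : ∀ a b c, a.1 ≠ b.1 →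
      (e a).norm + (e b).norm ≤ (c⁻¹ * e a * c).norm + (c⁻¹ * (e b * (e a)⁻¹) * c).norm)
    (a b c : Fin 2 × Bool) (hb : b ≠ a) (hc : c ≠ (a.1, !a.2)) :
    FreeGroup.lcpNorm (e a) (e b) + FreeGroup.lcpNorm (e a)⁻¹ (e c) < (e a).norm := by
  have hinv' : ∀ a : Fin 2 × Bool, e (a.1, !a.2) = (e a)⁻¹ := fun a => hinv a.1 a.2
  have self : ∀ a, 2 * FreeGroup.lcpNorm (e a)⁻¹ (e a) < (e a).norm :=
    fun a => FreeGroup.two_mul_lcpNorm_inv_self_lt (hne a)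
  have half : ∀ a b, a.1 ≠ b.1 → 2 * FreeGroup.lcpNorm (e a)⁻¹ (e b) ≤ (e a).norm := by
    intro a b hab
    have := FreeGroup.norm_mul (e a) (e b)
    have := h1 a b hab
    omega
  have half' : ∀ a b, a.1 ≠ b.1 → 2 * FreeGroup.lcpNorm (e a) (e b) ≤ (e a).norm := by
    intro a b hab
    have := half (a.1, !a.2) b hab
    rwa [hinv', inv_inv, FreeGroup.norm_inv_eq] at this
  have same : ∀ d : Fin 2 × Bool, d.1 = a.1 → d = a ∨ d = (a.1, !a.2) := by
    intro d hd
    rcases eq_or_ne d.2 a.2 with h | h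
    · exact Or.inl (Prod.ext hd h)
    · exact Or.inr (Prod.ext hd (by revert h; cases d.2 <;> cases a.2 <;> simp))
  by_cases hab : a.1 = b.1
  · obtain rfl := (same b hab.symm).resolve_left hb
    rw [hinv', FreeGroup.lcpNorm_comm]
    have s1 := self a
    by_cases hac : a.1 = c.1
    · obtain rfl := (same c hac.symm).resolve_right hc
      omega
    · have := half a c hac
      omega
  · have s2 := half' a b hab
    by_cases hac : a.1 = c.1
    · obtain rfl := (same c hac.symm).resolve_right hc
      have := self c
      omega
    · have s3 := half a c hac
      by_contra! hlt
      have hbc : b.1 = c.1 := by omega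
      have e1 : 2 * FreeGroup.lcpNorm (e a) (e b) = (e a).norm := by omega
      have e2 : 2 * FreeGroup.lcpNorm (e a)⁻¹ (e c) = (e a).norm := by omega
      by_cases hbc2 : b.2 = c.2
      · obtain rfl : b = c := Prod.ext hbc hbc2
        have := FreeGroup.min_lcpNorm_le (e a)⁻¹ (e b) (e a)
        rw [FreeGroup.lcpNorm_comm (e b)] at this
        have := self a
        omega
      · have hcb : e c = (e b)⁻¹ := by
          rw [← hinv']
          congr 1
          exact Prod.ext hbc.symm (by revert hbc2; cases b.2 <;> cases c.2 <;> simp)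
        rw [hcb] at e2
        have hle : (e a).norm ≤ (e b).norm := by
          have i1 := FreeGroup.norm_inv_mul (e a) (e b)
          have i2 := h1 (b.1, !b.2) a (Ne.symm hab)
          rw [hinv', ← FreeGroup.norm_inv_eq (x := (e b)⁻¹ * e a), mul_inv_rev, inv_inv] at i2
          omega
        obtain ⟨P, A, B, p1, p2, p3⟩ :=
          FreeGroup.exists_eq_append_of_lcpLength (e a).toWord (e b).toWord
        obtain ⟨Q, A', B', q1, q2, q3⟩ :=
          FreeGroup.exists_eq_append_of_lcpLength (e a)⁻¹.toWord (e b)⁻¹.toWord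
        have na : (e a).norm = (e a).toWord.length := rfl
        have nb : (e b).norm = (e b).toWord.length := rfl
        have lA := congrArg List.length p2
        have lB := congrArg List.length p3
        rw [FreeGroup.toWord_inv] at q2 q3
        have q2' := congrArg FreeGroup.invRev q2
        have q3' := congrArg FreeGroup.invRev q3
        rw [FreeGroup.invRev_invRev, FreeGroup.invRev_append] at q2' q3'
        have lA' := congrArg List.length q2'
        simp only [List.length_append, FreeGroup.invRev_length] at lA lB lA'
        change P.length = FreeGroup.lcpNorm (e a) (e b) at p1
        change Q.length = FreeGroup.lcpNorm (e a)⁻¹ (e b)⁻¹ at q1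
        have hA : A = FreeGroup.invRev Q := by
          have := p2.symm.trans q2'
          exact (List.append_inj' this (by rw [FreeGroup.invRev_length]; omega)).2
        obtain ⟨Z, hZ⟩ : FreeGroup.invRev Q <:+ B := by
          refine List.suffix_of_suffix_length_le (l₃ := (e b).toWord) ⟨_, q3'.symm⟩
            ⟨_, p3.symm⟩ ?_
          rw [FreeGroup.invRev_length]; omega
        have ea : e a = FreeGroup.mk P * FreeGroup.mk A := by
          rw [FreeGroup.mul_mk, ← p2, FreeGroup.mk_toWord]
        have eb : e b = FreeGroup.mk P * (FreeGroup.mk Z * FreeGroup.mk A) := by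
          rw [FreeGroup.mul_mk, FreeGroup.mul_mk, hA, hZ, ← p3, FreeGroup.mk_toWord]
        have m := h2 a b (FreeGroup.mk P) hab
        have c1 : (FreeGroup.mk P)⁻¹ * e a * FreeGroup.mk P = FreeGroup.mk (A ++ P) := by
          rw [ea, ← FreeGroup.mul_mk]; group
        have c2 : (FreeGroup.mk P)⁻¹ * (e b * (e a)⁻¹) * FreeGroup.mk P = FreeGroup.mk Z := by
          rw [ea, eb]; group
        rw [c1, c2] at m
        have n1 : (FreeGroup.mk (A ++ P)).norm ≤ _ := FreeGroup.norm_mk_le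
        have n2 : (FreeGroup.mk Z).norm ≤ _ := FreeGroup.norm_mk_le
        have lZ := congrArg List.length hZ
        simp only [List.length_append, FreeGroup.invRev_length] at n1 lZ
        have npos : (e a).norm ≠ 0 := fun h => hne a (FreeGroup.norm_eq_zero.mp h)
        omega

section Decomposition

variable {Q : Type*} [Group Q] {w e r f : Q}

theorem conj_mem_of_mem_closure (hw : w * w = 1) (he : e * e = 1)
    (her : e * r * e = r⁻¹) (hel : e * (w * r * w) * e = (w * r * w)⁻¹) {F : Q}
    (hF : F ∈ Subgroup.closure {w, e}) :
    (∀ t ∈ ({r, w * r * w, r⁻¹, (w * r * w)⁻¹} : Set Q),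
      F * t * F⁻¹ ∈ ({r, w * r * w, r⁻¹, (w * r * w)⁻¹} : Set Q)) := by
  have hw' : w⁻¹ = w := inv_eq_of_mul_eq_one_left hw
  have he' : e⁻¹ = e := inv_eq_of_mul_eq_one_left he
  have hww : ∀ a, w * (w * a) = a := fun a => by rw [← mul_assoc, hw, one_mul]
  have hee : ∀ a, e * (e * a) = a := fun a => by rw [← mul_assoc, he, one_mul]
  have her' : e * r⁻¹ * e = r := by rw [← her]; simp [mul_assoc, he, hee]
  have hel' : e * (w * r * w)⁻¹ * e = w * r * w := by
    rw [← hel]; simp only [mul_assoc, he, hee, mul_one]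
  have W : ∀ t ∈ ({r, w * r * w, r⁻¹, (w * r * w)⁻¹} : Set Q),
      w * t * w ∈ ({r, w * r * w, r⁻¹, (w * r * w)⁻¹} : Set Q) := by
    rintro t (rfl | rfl | rfl | rfl) <;> simp [mul_assoc, hw', hw, hww]
  have E : ∀ t ∈ ({r, w * r * w, r⁻¹, (w * r * w)⁻¹} : Set Q),
      e * t * e ∈ ({r, w * r * w, r⁻¹, (w * r * w)⁻¹} : Set Q) := by
    rintro t (rfl | rfl | rfl | rfl)
    · rw [her]; simp
    · rw [hel]; simp
    · rw [her']; simp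
    · rw [hel']; simp
  induction hF using Subgroup.closure_induction_left with
  | one => simp
  | mul_left x hx y hy ih =>
    intro t ht
    have h2 : x * y * t * (x * y)⁻¹ = x * (y * t * y⁻¹) * x⁻¹ := by group
    rw [h2]
    rcases hx with rfl | rfl
    · rw [hw']; exact W _ (ih t ht)
    · rw [he']; exact E _ (ih t ht)
  | inv_mul_cancel x hx y hy ih =>
    intro t ht
    have h2 : x⁻¹ * y * t * (x⁻¹ * y)⁻¹ = x⁻¹ * (y * t * y⁻¹) * x := by group
    rw [h2]
    rcases hx with rfl | rfl
    · rw [hw']; exact W _ (ih t ht)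
    · rw [he']; exact E _ (ih t ht)

/-- Relations under which a group generated by two involutions and a transvection consists of
products of a positive word with elements of the group generated by the involutions. -/
theorem exists_eq_mul_mul_of_mem_closure (hw : w * w = 1) (he : e * e = 1)
    (her : e * r * e = r⁻¹) (hel : e * (w * r * w) * e = (w * r * w)⁻¹)
    (hf : f ∈ Subgroup.closure {w, e}) (hlr : w * r * w * r⁻¹ = r * f)
    {g : Q} (hg : g ∈ Subgroup.closure {w, e, r}) :
    ∃ F ∈ Subgroup.closure {w, e}, ∃ P ∈ Submonoid.closure {r, w * r * w},
      ∃ F' ∈ Subgroup.closure {w, e}, g = F * P * F' := by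
  have hwD : w ∈ Subgroup.closure {w, e} := Subgroup.subset_closure (by simp)
  have heD : e ∈ Subgroup.closure {w, e} := Subgroup.subset_closure (by simp)
  have hw' : w⁻¹ = w := inv_eq_of_mul_eq_one_left hw
  have he' : e⁻¹ = e := inv_eq_of_mul_eq_one_left he
  have hww : ∀ a, w * (w * a) = a := fun a => by rw [← mul_assoc, hw, one_mul]
  have hrl : r * (w * r * w)⁻¹ = w * r * w * (w * f * w) := by
    calc r * (w * r * w)⁻¹ = w * (w * r * w * r⁻¹) * w := by simp [mul_assoc, hw', hww]
      _ = w * r * w * (w * f * w) := by rw [hlr]; simp only [mul_assoc, hww]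
  have hr : r ∈ Submonoid.closure {r, w * r * w} := Submonoid.subset_closure (by simp)
  have hl : w * r * w ∈ Submonoid.closure {r, w * r * w} := Submonoid.subset_closure (by simp)
  have absorb : ∀ P ∈ Submonoid.closure {r, w * r * w},
      ∀ t ∈ ({r, w * r * w, r⁻¹, (w * r * w)⁻¹} : Set Q),
      ∃ F ∈ Subgroup.closure {w, e}, ∃ P' ∈ Submonoid.closure {r, w * r * w},
        ∃ F' ∈ Subgroup.closure {w, e}, P * t = F * P' * F' := by
    rintro P hP t (rfl | rfl | rfl | rfl)
    · exact ⟨1, one_mem _, _, mul_mem hP hr, 1, one_mem _, by simp⟩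
    · exact ⟨1, one_mem _, _, mul_mem hP hl, 1, one_mem _, by simp⟩
    · induction hP using Submonoid.closure_induction_right with
      | one => exact ⟨e, heD, r, hr, e, heD, by simp [her]⟩
      | mul_right x hx y hy _ =>
        rcases hy with rfl | rfl
        · exact ⟨1, one_mem _, x, hx, 1, one_mem _, by simp⟩
        · exact ⟨1, one_mem _, x * r, mul_mem hx hr, f, hf, by
            rw [mul_assoc x, hlr, one_mul, mul_assoc]⟩
    · induction hP using Submonoid.closure_induction_right with
      | one => exact ⟨e, heD, _, hl, e, heD, by rw [hel, one_mul]⟩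
      | mul_right x hx y hy _ =>
        rcases hy with rfl | rfl
        · exact ⟨1, one_mem _, x * (w * y * w), mul_mem hx hl, w * f * w,
            mul_mem (mul_mem hwD hf) hwD, by rw [mul_assoc x, hrl, one_mul, ← mul_assoc x]⟩
        · exact ⟨1, one_mem _, x, hx, 1, one_mem _, by rw [mul_inv_cancel_right]; simp⟩
  have step : ∀ t ∈ ({r, w * r * w, r⁻¹, (w * r * w)⁻¹} : Set Q), ∀ g : Q,
      (∃ F ∈ Subgroup.closure {w, e}, ∃ P ∈ Submonoid.closure {r, w * r * w},
        ∃ F' ∈ Subgroup.closure {w, e}, g = F * P * F') →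
      ∃ F ∈ Subgroup.closure {w, e}, ∃ P ∈ Submonoid.closure {r, w * r * w},
        ∃ F' ∈ Subgroup.closure {w, e}, g * t = F * P * F' := by
    rintro t ht _ ⟨F, hF, P, hP, F', hF', rfl⟩
    obtain ⟨F₁, h1, P', h2, F₂, h3, h4⟩ :=
      absorb P hP _ (conj_mem_of_mem_closure hw he her hel hF' t ht)
    refine ⟨F * F₁, mul_mem hF h1, P', h2, F₂ * F', mul_mem h3 hF', ?_⟩
    calc F * P * F' * t = F * (P * (F' * t * F'⁻¹)) * F' := by group
      _ = _ := by rw [h4]; group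
  induction hg using Subgroup.closure_induction_right with
  | one => exact ⟨1, one_mem _, 1, one_mem _, 1, one_mem _, by simp⟩
  | mul_right x hx y hy ih =>
    rcases hy with rfl | rfl | rfl
    · obtain ⟨F, hF, P, hP, F', hF', rfl⟩ := ih
      exact ⟨F, hF, P, hP, F' * y, mul_mem hF' hwD, by group⟩
    · obtain ⟨F, hF, P, hP, F', hF', rfl⟩ := ih
      exact ⟨F, hF, P, hP, F' * y, mul_mem hF' heD, by group⟩
    · exact step _ (by simp) _ ih
  | mul_inv_cancel x hx y hy ih =>
    rcases hy with rfl | rfl | rfl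
    · obtain ⟨F, hF, P, hP, F', hF', rfl⟩ := ih
      exact ⟨F, hF, P, hP, F' * y⁻¹, mul_mem hF' (inv_mem hwD), by group⟩
    · obtain ⟨F, hF, P, hP, F', hF', rfl⟩ := ih
      exact ⟨F, hF, P, hP, F' * y⁻¹, mul_mem hF' (inv_mem heD), by group⟩
    · exact step _ (by simp) _ ih

end Decomposition

theorem F2.hom_ext {G : Type*} [Group G] {φ ψ : F2 →* G} (hx : φ xg = ψ xg)
    (hy : φ yg = ψ yg) : φ = ψ := by
  refine FreeGroup.ext_hom _ _ fun i => ?_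
  fin_cases i
  · exact hx
  · exact hy

theorem F2.aut_ext {φ ψ : MulAut F2} (hx : φ xg = ψ xg) (hy : φ yg = ψ yg) : φ = ψ :=
  MulEquiv.toMonoidHom_injective (F2.hom_ext hx hy)

/-- The endomorphism of `F₂` sending `x` to `u` and `y` to `v`. -/
def F2.lift {G : Type*} [Group G] (u v : G) : F2 →* G := FreeGroup.lift ![u, v]

@[simp] theorem F2.lift_xg {G : Type*} [Group G] (u v : G) : F2.lift u v xg = u := by
  simp [F2.lift, xg]

@[simp] theorem F2.lift_yg {G : Type*} [Group G] (u v : G) : F2.lift u v yg = v := by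
  simp [F2.lift, yg]

/-- The automorphism of `F₂` exchanging `x` and `y`. -/
def swapAut : MulAut F2 :=
  MonoidHom.toMulEquiv (F2.lift yg xg) (F2.lift yg xg) (F2.hom_ext (by simp) (by simp))
    (F2.hom_ext (by simp) (by simp))

/-- The automorphism of `F₂` inverting `x` and fixing `y`. -/
def negAut : MulAut F2 :=
  MonoidHom.toMulEquiv (F2.lift xg⁻¹ yg) (F2.lift xg⁻¹ yg) (F2.hom_ext (by simp) (by simp))
    (F2.hom_ext (by simp) (by simp))

/-- The automorphism of `F₂` fixing `x` and sending `y` to `x ^ s * y`. -/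
def shearAut (s : ℤ) : MulAut F2 :=
  MonoidHom.toMulEquiv (F2.lift xg (xg ^ s * yg)) (F2.lift xg (xg ^ (-s) * yg))
    (F2.hom_ext (by simp) (by simp)) (F2.hom_ext (by simp) (by simp))

@[simp] theorem swapAut_xg : swapAut xg = yg := F2.lift_xg yg xg
@[simp] theorem swapAut_yg : swapAut yg = xg := F2.lift_yg yg xg
@[simp] theorem negAut_xg : negAut xg = xg⁻¹ := F2.lift_xg xg⁻¹ yg
@[simp] theorem negAut_yg : negAut yg = yg := F2.lift_yg xg⁻¹ yg
@[simp] theorem shearAut_xg (s : ℤ) : shearAut s xg = xg := F2.lift_xg xg (xg ^ s * yg)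
@[simp] theorem shearAut_yg (s : ℤ) : shearAut s yg = xg ^ s * yg :=
  F2.lift_yg xg (xg ^ s * yg)
@[simp] theorem shearAut_symm_xg (s : ℤ) : MulEquiv.symm (shearAut s) xg = xg :=
  F2.lift_xg xg (xg ^ (-s) * yg)
@[simp] theorem shearAut_symm_yg (s : ℤ) : MulEquiv.symm (shearAut s) yg = xg ^ (-s) * yg :=
  F2.lift_yg xg (xg ^ (-s) * yg)

/-- The signed permutations of the basis `x, y`. -/
def signedPerms : Subgroup (MulAut F2) := Subgroup.closure {swapAut, negAut}

theorem swapAut_mem : swapAut ∈ signedPerms := Subgroup.subset_closure (by simp)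

theorem negAut_mem : negAut ∈ signedPerms := Subgroup.subset_closure (by simp)

theorem exists_signedPerm (a b : Fin 2 × Bool) (hab : a.1 ≠ b.1) :
    ∃ F ∈ signedPerms, F xg = FreeGroup.mk [a] ∧ F yg = FreeGroup.mk [b] := by
  have h1 : FreeGroup.mk [((0 : Fin 2), true)] = xg := rfl
  have h2 : FreeGroup.mk [((0 : Fin 2), false)] = xg⁻¹ := rfl
  have h3 : FreeGroup.mk [((1 : Fin 2), true)] = yg := rfl
  have h4 : FreeGroup.mk [((1 : Fin 2), false)] = yg⁻¹ := rfl
  have hw := swapAut_mem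
  have he := negAut_mem
  have hd := mul_mem (mul_mem hw he) hw
  obtain ⟨i, p⟩ := a
  obtain ⟨j, q⟩ := b
  fin_cases i <;> fin_cases j <;> simp at hab <;> cases p <;> cases q <;>
    simp only [Fin.zero_eta, Fin.mk_one, h1, h2, h3, h4]
  · exact ⟨_, mul_mem he hd, by simp, by simp⟩
  · exact ⟨_, he, by simp, by simp⟩
  · exact ⟨_, hd, by simp, by simp⟩
  · exact ⟨1, one_mem _, by simp, by simp⟩
  · exact ⟨_, mul_mem hw (mul_mem he hd), by simp, by simp⟩
  · exact ⟨_, mul_mem hw he, by simp, by simp⟩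
  · exact ⟨_, mul_mem he hw, by simp, by simp⟩
  · exact ⟨_, hw, by simp, by simp⟩

theorem signedPerm_apply {F : MulAut F2} (hF : F ∈ signedPerms) :
    ((F xg = xg ∨ F xg = xg⁻¹) ∧ (F yg = yg ∨ F yg = yg⁻¹)) ∨
      ((F xg = yg ∨ F xg = yg⁻¹) ∧ (F yg = xg ∨ F yg = xg⁻¹)) := by
  have hw' : swapAut⁻¹ = swapAut :=
    inv_eq_of_mul_eq_one_left (F2.aut_ext (by simp) (by simp))
  have he' : negAut⁻¹ = negAut :=
    inv_eq_of_mul_eq_one_left (F2.aut_ext (by simp) (by simp))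
  induction hF using Subgroup.closure_induction_right with
  | one => simp
  | mul_right F hF y hy ih =>
    rcases hy with rfl | rfl
    · simp only [MulAut.mul_apply, swapAut_xg, swapAut_yg]
      tauto
    · simp only [MulAut.mul_apply, negAut_xg, negAut_yg, map_inv, inv_eq_iff_eq_inv]
      tauto
  | mul_inv_cancel F hF y hy ih =>
    rcases hy with rfl | rfl
    · simp only [hw', MulAut.mul_apply, swapAut_xg, swapAut_yg]
      tauto
    · simp only [he', MulAut.mul_apply, negAut_xg, negAut_yg, map_inv, inv_eq_iff_eq_inv]
      tauto

@[simp] theorem expSum_zero_xg : expSum 0 xg = Multiplicative.ofAdd 1 := by simp [expSum, xg]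
@[simp] theorem expSum_zero_yg : expSum 0 yg = 1 := by simp [expSum, yg]
@[simp] theorem expSum_one_xg : expSum 1 xg = 1 := by simp [expSum, xg]
@[simp] theorem expSum_one_yg : expSum 1 yg = Multiplicative.ofAdd 1 := by simp [expSum, yg]

theorem autMat_eq (γ : F2 ≃* F2) : autMat γ =
    !![(expSum 0 (γ xg)).toAdd, (expSum 0 (γ yg)).toAdd;
      (expSum 1 (γ xg)).toAdd, (expSum 1 (γ yg)).toAdd] := by
  ext i j
  fin_cases i <;> fin_cases j <;> rfl

theorem toAdd_expSum_apply (γ : F2 ≃* F2) (i : Fin 2) (g : F2) :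
    (expSum i (γ g)).toAdd =
      (expSum i (γ xg)).toAdd * (expSum 0 g).toAdd +
        (expSum i (γ yg)).toAdd * (expSum 1 g).toAdd := by
  have : (expSum i).comp γ.toMonoidHom =
      (zpowersHom _ (expSum i (γ xg))).comp (expSum 0) *
        (zpowersHom _ (expSum i (γ yg))).comp (expSum 1) :=
    F2.hom_ext (by simp [zpowersHom]) (by simp [zpowersHom])
  have := DFunLike.congr_fun this g
  have := congrArg Multiplicative.toAdd this
  simpa [mul_comm, zpowersHom] using this

theorem autMat_mul (φ ψ : MulAut F2) : autMat (φ * ψ) = autMat φ * autMat ψ := by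
  rw [autMat_eq, autMat_eq, autMat_eq, Matrix.mul_fin_two]
  simp only [MulAut.mul_apply]
  rw [toAdd_expSum_apply φ 0 (ψ xg), toAdd_expSum_apply φ 0 (ψ yg),
    toAdd_expSum_apply φ 1 (ψ xg), toAdd_expSum_apply φ 1 (ψ yg)]

theorem autMat_one : autMat (1 : MulAut F2) = 1 := by
  rw [autMat_eq, Matrix.one_fin_two]
  simp

theorem autMat_conj (c : F2) : autMat (MulAut.conj c) = 1 := by
  rw [autMat_eq, Matrix.one_fin_two]
  simp

theorem autMat_shearAut (s : ℤ) : autMat (shearAut s) = !![1, s; 0, 1] := by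
  rw [autMat_eq]
  simp

theorem eq_one_of_mem_signedPerms {F : MulAut F2} (hF : F ∈ signedPerms)
    (h : autMat F = 1) : F = 1 := by
  rw [autMat_eq, Matrix.one_fin_two] at h
  rcases signedPerm_apply hF with ⟨h1 | h1, h2 | h2⟩ | ⟨h1 | h1, h2 | h2⟩ <;>
    simp [h1, h2] at h
  exact F2.aut_ext h1 h2

theorem sum_autMat_le_two {F : MulAut F2} (hF : F ∈ signedPerms) :
    autMat F 0 0 + autMat F 1 0 + (autMat F 0 1 + autMat F 1 1) ≤ 2 := by
  rw [autMat_eq]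
  rcases signedPerm_apply hF with ⟨h1 | h1, h2 | h2⟩ | ⟨h1 | h1, h2 | h2⟩ <;>
    simp [h1, h2]

theorem autMat_of_mem_positive {P : MulAut F2}
    (hP : P ∈ Submonoid.closure {shearAut 1, swapAut * shearAut 1 * swapAut}) :
    (1 ≤ autMat P 0 0 + autMat P 1 0 ∧ 1 ≤ autMat P 0 1 + autMat P 1 1) ∧
      (P = 1 ∨ 3 ≤ autMat P 0 0 + autMat P 1 0 + (autMat P 0 1 + autMat P 1 1)) := by
  have hl : autMat (swapAut * shearAut 1 * swapAut) = !![1, 0; 1, 1] := by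
    rw [autMat_eq]
    simp
  induction hP using Submonoid.closure_induction_right with
  | one => simp [autMat_one]
  | mul_right x hx y hy ih =>
    rcases hy with rfl | rfl
    · rw [autMat_mul, autMat_shearAut]
      simp [Matrix.mul_apply, Fin.sum_univ_two]
      omega
    · rw [autMat_mul, hl]
      simp [Matrix.mul_apply, Fin.sum_univ_two]
      omega

theorem conj_range_normal : (MulAut.conj : F2 →* MulAut F2).range.Normal := by
  refine ⟨?_⟩
  rintro _ ⟨c, rfl⟩ φ
  refine ⟨φ c, ?_⟩
  ext g
  simp

/-- The subgroup of `Aut(F₂)` generated by the elementary Nielsen and the inner automorphisms. -/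
def nielsenSubgroup : Subgroup (MulAut F2) :=
  Subgroup.closure {swapAut, negAut, shearAut 1} ⊔ (MulAut.conj : F2 →* MulAut F2).range

theorem exists_conj_eq_of_mem_nielsenSubgroup {γ : MulAut F2} (hγ : γ ∈ nielsenSubgroup)
    (h : autMat γ = 1) : ∃ c, γ = MulAut.conj c := by
  have := conj_range_normal
  let π := QuotientGroup.mk' (MulAut.conj : F2 →* MulAut F2).range
  have hπ : ∀ φ ψ : MulAut F2, (∃ c, φ = MulAut.conj c * ψ) → π φ = π ψ := by
    rintro φ ψ ⟨c, rfl⟩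
    rw [map_mul, show π (MulAut.conj c) = 1 from
      (QuotientGroup.eq_one_iff _).mpr (MonoidHom.mem_range.mpr ⟨c, rfl⟩), one_mul]
  have hγ' : π γ ∈ Subgroup.closure {π swapAut, π negAut, π (shearAut 1)} := by
    have := Subgroup.mem_map_of_mem π hγ
    rw [nielsenSubgroup, Subgroup.map_sup, MonoidHom.map_closure] at this
    have hker : Subgroup.map π (MulAut.conj : F2 →* MulAut F2).range = ⊥ := by
      rw [Subgroup.map_eq_bot_iff, QuotientGroup.ker_mk']
    rw [hker, sup_bot_eq] at this
    simpa [Set.image_insert_eq] using this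
  have key := exists_eq_mul_mul_of_mem_closure (w := π swapAut) (e := π negAut)
    (r := π (shearAut 1)) (f := π (swapAut * (swapAut * negAut * swapAut)))
    (by rw [← map_mul, ← map_one π]; congr 1; exact F2.aut_ext (by simp) (by simp))
    (by rw [← map_mul, ← map_one π]; congr 1; exact F2.aut_ext (by simp) (by simp))
    (by
      simp only [← map_mul, ← map_inv]
      congr 1
      exact F2.aut_ext (by simp) (by simp))
    (by
      rw [eq_inv_iff_mul_eq_one]
      simp only [← map_mul]
      rw [← map_one π]
      exact hπ _ _ ⟨yg, F2.aut_ext (by simp [mul_assoc]) (by simp)⟩)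
    (by
      simp only [map_mul]
      have hw : π swapAut ∈ Subgroup.closure {π swapAut, π negAut} :=
        Subgroup.subset_closure (by simp)
      have he : π negAut ∈ Subgroup.closure {π swapAut, π negAut} :=
        Subgroup.subset_closure (by simp)
      exact mul_mem hw (mul_mem (mul_mem hw he) hw))
    (by
      simp only [← map_mul, ← map_inv]
      exact hπ _ _ ⟨xg⁻¹, F2.aut_ext (by simp [mul_assoc]) (by simp)⟩) hγ'
  obtain ⟨F, hF, P, hP, F', hF', hg⟩ := key
  have hD : Subgroup.closure {π swapAut, π negAut} = signedPerms.map π := by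
    rw [signedPerms, MonoidHom.map_closure, Set.image_pair]
  have hM : Submonoid.closure {π (shearAut 1), π swapAut * π (shearAut 1) * π swapAut} =
      (Submonoid.closure {shearAut 1, swapAut * shearAut 1 * swapAut}).map π := by
    rw [MonoidHom.map_mclosure, Set.image_pair, map_mul, map_mul]
  rw [hD] at hF hF'
  rw [hM] at hP
  obtain ⟨F, hF, rfl⟩ := hF
  obtain ⟨F', hF', rfl⟩ := hF'
  obtain ⟨P, hP, rfl⟩ := hP
  rw [← map_mul, ← map_mul] at hg
  obtain ⟨c, hc⟩ : γ * (F * P * F')⁻¹ ∈ (MulAut.conj : F2 →* MulAut F2).range := by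
    rw [← QuotientGroup.eq_one_iff]
    change π (γ * (F * P * F')⁻¹) = 1
    rw [map_mul, hg, map_inv, mul_inv_cancel]
  have hγ2 : γ = MulAut.conj c * (F * P * F') := by rw [hc]; group
  have hG := mul_mem (inv_mem hF) (inv_mem hF')
  have hPG : autMat P = autMat (F⁻¹ * F'⁻¹) := by
    have h1 : P = F⁻¹ * ((MulAut.conj c)⁻¹ * γ) * F'⁻¹ := by rw [hγ2]; group
    rw [h1, autMat_mul, autMat_mul, autMat_mul, h, ← map_inv, autMat_conj, autMat_mul]
    simp
  have h2 := sum_autMat_le_two hG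
  rw [← hPG] at h2
  have hP1 : P = 1 := (autMat_of_mem_positive hP).2.resolve_right (by omega)
  rw [hP1, autMat_one] at hPG
  have h3 : F' * F = 1 := by
    rw [← inv_eq_one, mul_inv_rev]
    exact eq_one_of_mem_signedPerms hG hPG.symm
  exact ⟨c, by rw [hγ2, hP1, mul_one, mul_eq_one_comm.mp h3, mul_one]⟩

theorem signedPerms_le_nielsenSubgroup : signedPerms ≤ nielsenSubgroup :=
  (Subgroup.closure_mono (by grind)).trans le_sup_left

theorem shearAut_one_mem : shearAut 1 ∈ nielsenSubgroup :=
  (le_sup_left : _ ≤ nielsenSubgroup) (Subgroup.subset_closure (by simp))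

theorem conj_mem_nielsenSubgroup (c : F2) : MulAut.conj c ∈ nielsenSubgroup :=
  (le_sup_right : _ ≤ nielsenSubgroup) (MonoidHom.mem_range.mpr ⟨c, rfl⟩)

theorem mem_nielsenSubgroup_of_norm_le {γ : MulAut F2}
    (h : ∀ g, g.norm ≤ (γ g).norm) : γ ∈ nielsenSubgroup := by
  have letter : ∀ g : F2, g.norm = 1 → ∃ a, γ⁻¹ g = FreeGroup.mk [a] := by
    intro g hg
    have h1 := h (γ⁻¹ g)
    rw [MulAut.apply_inv_self, hg] at h1
    have h2 : (γ⁻¹ g).norm ≠ 0 := by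
      rw [Ne, FreeGroup.norm_eq_zero, map_eq_one_iff _ (γ⁻¹).injective, ← FreeGroup.norm_eq_zero]
      omega
    obtain ⟨a, ha⟩ := List.length_eq_one_iff.mp (show (γ⁻¹ g).toWord.length = 1 by
      change (γ⁻¹ g).norm = 1; omega)
    exact ⟨a, by rw [← ha, FreeGroup.mk_toWord]⟩
  obtain ⟨a, ha⟩ := letter xg (FreeGroup.norm_of _)
  obtain ⟨b, hb⟩ := letter yg (FreeGroup.norm_of _)
  have hab : a.1 ≠ b.1 := by
    intro hab
    have : γ⁻¹ yg = γ⁻¹ xg ∨ γ⁻¹ yg = γ⁻¹ xg⁻¹ := by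
      rw [map_inv, ha, hb, FreeGroup.inv_mk]
      obtain ⟨i, p⟩ := a
      obtain ⟨j, q⟩ := b
      obtain rfl : i = j := hab
      cases p <;> cases q <;> simp [FreeGroup.invRev]
    rcases this with h | h
    · have := congrArg (expSum 0) ((γ⁻¹).injective h)
      rw [expSum_zero_xg, expSum_zero_yg] at this
      exact zero_ne_one (α := ℤ) this
    · have := congrArg (expSum 0) ((γ⁻¹).injective h)
      simp at this
  obtain ⟨F, hF, hFx, hFy⟩ := exists_signedPerm a b hab
  rw [← inv_mem_iff, show γ⁻¹ = F from F2.aut_ext (ha.trans hFx.symm) (hb.trans hFy.symm)]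
  exact signedPerms_le_nielsenSubgroup hF

/-- **Nielsen's theorem** in rank two. -/
theorem mem_nielsenSubgroup (γ : MulAut F2) : γ ∈ nielsenSubgroup := by
  induction hk : (γ xg).norm + (γ yg).norm using Nat.strong_induction_on generalizing γ with
  | _ k ih =>
  by_contra hγ
  have hmin : ∀ c : F2, ∀ δ ∈ nielsenSubgroup,
      k ≤ (c⁻¹ * γ (δ xg) * c).norm + (c⁻¹ * γ (δ yg) * c).norm := by
    intro c δ hδ
    by_contra! hlt
    have := ih _ hlt (MulAut.conj c⁻¹ * γ * δ) (by simp)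
    rw [Subgroup.mul_mem_cancel_right _ hδ,
      Subgroup.mul_mem_cancel_left _ (conj_mem_nielsenSubgroup _)] at this
    exact hγ this
  let e : Fin 2 × Bool → F2 := fun a => γ (FreeGroup.mk [a])
  have hinv : ∀ i b, e (i, !b) = (e (i, b))⁻¹ := fun i b => by
    simp [e, ← map_inv, FreeGroup.inv_mk, FreeGroup.invRev]
  have hinv' : ∀ a : Fin 2 × Bool, e (a.1, !a.2) = (e a)⁻¹ := fun a => hinv a.1 a.2
  have hne : ∀ a, e a ≠ 1 := by
    intro a
    rw [Ne, map_eq_one_iff _ γ.injective, ← FreeGroup.norm_eq_zero, FreeGroup.norm,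
      FreeGroup.toWord_mk]
    simp
  have hmin' : ∀ a b : Fin 2 × Bool, a.1 ≠ b.1 → (e a).norm + (e b).norm = k := by
    have n1 : ∀ i p, (e (i, p)).norm = (e (i, true)).norm := by
      intro i p
      cases p
      · rw [← FreeGroup.norm_inv_eq, ← hinv]; rfl
      · rfl
    rintro ⟨i, p⟩ ⟨j, q⟩ hab
    rw [n1 i, n1 j]
    change i ≠ j at hab
    have hk' : (e (0, true)).norm + (e (1, true)).norm = k := hk
    fin_cases i <;> fin_cases j <;> simp at hab ⊢ <;> omega
  have h1 : ∀ a b, a.1 ≠ b.1 → (e b).norm ≤ (e a * e b).norm := by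
    intro a b hab
    obtain ⟨F, hF, hFx, hFy⟩ := exists_signedPerm a b hab
    have := hmin 1 (F * shearAut 1)
      (mul_mem (signedPerms_le_nielsenSubgroup hF) shearAut_one_mem)
    simp only [MulAut.mul_apply, shearAut_xg, shearAut_yg, zpow_one, map_mul, hFx, hFy,
      inv_one, one_mul, mul_one] at this
    change k ≤ (e a).norm + (e a * e b).norm at this
    have := hmin' a b hab
    omega
  have h2 : ∀ a b c, a.1 ≠ b.1 →
      (e a).norm + (e b).norm ≤ (c⁻¹ * e a * c).norm + (c⁻¹ * (e b * (e a)⁻¹) * c).norm := by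
    intro a b c hab
    obtain ⟨F, hF, hFx, hFy⟩ := exists_signedPerm a b hab
    have hneg : swapAut * negAut * swapAut ∈ nielsenSubgroup :=
      signedPerms_le_nielsenSubgroup
        (mul_mem (mul_mem swapAut_mem negAut_mem) swapAut_mem)
    have := hmin c (F * (swapAut * negAut * swapAut * shearAut 1 * (swapAut * negAut * swapAut)))
      (mul_mem (signedPerms_le_nielsenSubgroup hF)
        (mul_mem (mul_mem hneg shearAut_one_mem) hneg))
    simp only [MulAut.mul_apply, shearAut_xg, shearAut_yg, zpow_one, map_mul, hFx, hFy,
      swapAut_xg, swapAut_yg, negAut_xg, negAut_yg, map_inv, mul_inv_rev, inv_inv] at this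
    rw [hmin' a b hab]
    exact this
  refine hγ (mem_nielsenSubgroup_of_norm_le fun g => ?_)
  have hg := FreeGroup.isReduced_toWord (x := g)
  have hm := FreeGroup.mk_toWord (x := g)
  rw [FreeGroup.norm]
  generalize g.toWord = L at hg hm
  subst hm
  cases L with
  | nil => simp
  | cons a L =>
    have := (FreeGroup.length_add_lcpNorm_le γ.toMonoidHom (fun a b c hb hc =>
      nielsen_reduced e hinv hne h1 h2 a b c hb hc) L a hg (a.1, !a.2)
        (fun h => by simpa using congrArg Prod.snd h)).2
    rw [List.length_cons]
    exact (Nat.le_add_right _ _).trans this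

/-- An automorphism of `F₂` acting trivially on the abelianization is inner. -/
theorem exists_conj_eq {γ : MulAut F2} (h : autMat γ = 1) : ∃ c, γ = MulAut.conj c :=
  exists_conj_eq_of_mem_nielsenSubgroup (mem_nielsenSubgroup γ) h

section Monodromy

/-- The squares of the origami of `Hₙ`: copies, indexed by `ℤ/n`, of the five squares of `D`. -/
abbrev Square (n : ℕ) := Fin 5 × ZMod n

/-- The monodromy of the horizontal generator. -/
def horizontalPerm (n : ℕ) : Equiv.Perm (Square n) where
  toFun p := match p with
    | (0, k) => (2, k - 1)
    | (1, k) => (0, k)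
    | (2, k) => (1, k)
    | (3, k) => (3, k)
    | (4, k) => (4, k)
  invFun p := match p with
    | (0, k) => (1, k)
    | (1, k) => (2, k)
    | (2, k) => (0, k + 1)
    | (3, k) => (3, k)
    | (4, k) => (4, k)
  left_inv := by rintro ⟨i, k⟩; fin_cases i <;> simp
  right_inv := by rintro ⟨i, k⟩; fin_cases i <;> simp

/-- The monodromy of the vertical generator. -/
def verticalPerm (n : ℕ) : Equiv.Perm (Square n) where
  toFun p := match p with
    | (0, k) => (4, k)
    | (1, k) => (2, k)
    | (2, k) => (1, k)
    | (3, k) => (0, k)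
    | (4, k) => (3, k)
  invFun p := match p with
    | (0, k) => (3, k)
    | (1, k) => (2, k)
    | (2, k) => (1, k)
    | (3, k) => (4, k)
    | (4, k) => (0, k)
  left_inv := by rintro ⟨i, k⟩; fin_cases i <;> simp
  right_inv := by rintro ⟨i, k⟩; fin_cases i <;> simp

/-- The action of `F₂` on the squares of the origami of `Hₙ`, chosen such that `Hₙ` is the
stabilizer of `(0, 0)`. -/
def monodromy (n : ℕ) : F2 →* Equiv.Perm (Square n) :=
  F2.lift (horizontalPerm n) (verticalPerm n)

variable {n : ℕ}

@[simp] theorem monodromy_xg : monodromy n xg = horizontalPerm n := F2.lift_xg _ _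
@[simp] theorem monodromy_yg : monodromy n yg = verticalPerm n := F2.lift_yg _ _

@[simp] theorem horizontalPerm_zero (k : ZMod n) : horizontalPerm n (0, k) = (2, k - 1) := rfl
@[simp] theorem horizontalPerm_one (k : ZMod n) : horizontalPerm n (1, k) = (0, k) := rfl
@[simp] theorem horizontalPerm_two (k : ZMod n) : horizontalPerm n (2, k) = (1, k) := rfl
@[simp] theorem horizontalPerm_three (k : ZMod n) : horizontalPerm n (3, k) = (3, k) := rfl
@[simp] theorem horizontalPerm_four (k : ZMod n) : horizontalPerm n (4, k) = (4, k) := rfl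
@[simp] theorem horizontalPerm_symm_zero (k : ZMod n) :
    (horizontalPerm n).symm (0, k) = (1, k) := rfl
@[simp] theorem horizontalPerm_symm_one (k : ZMod n) :
    (horizontalPerm n).symm (1, k) = (2, k) := rfl
@[simp] theorem horizontalPerm_symm_two (k : ZMod n) :
    (horizontalPerm n).symm (2, k) = (0, k + 1) := rfl
@[simp] theorem horizontalPerm_symm_three (k : ZMod n) :
    (horizontalPerm n).symm (3, k) = (3, k) := rfl
@[simp] theorem horizontalPerm_symm_four (k : ZMod n) :
    (horizontalPerm n).symm (4, k) = (4, k) := rfl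
@[simp] theorem verticalPerm_zero (k : ZMod n) : verticalPerm n (0, k) = (4, k) := rfl
@[simp] theorem verticalPerm_one (k : ZMod n) : verticalPerm n (1, k) = (2, k) := rfl
@[simp] theorem verticalPerm_two (k : ZMod n) : verticalPerm n (2, k) = (1, k) := rfl
@[simp] theorem verticalPerm_three (k : ZMod n) : verticalPerm n (3, k) = (0, k) := rfl
@[simp] theorem verticalPerm_four (k : ZMod n) : verticalPerm n (4, k) = (3, k) := rfl
@[simp] theorem verticalPerm_symm_zero (k : ZMod n) :
    (verticalPerm n).symm (0, k) = (3, k) := rfl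
@[simp] theorem verticalPerm_symm_one (k : ZMod n) :
    (verticalPerm n).symm (1, k) = (2, k) := rfl
@[simp] theorem verticalPerm_symm_two (k : ZMod n) :
    (verticalPerm n).symm (2, k) = (1, k) := rfl
@[simp] theorem verticalPerm_symm_three (k : ZMod n) :
    (verticalPerm n).symm (3, k) = (4, k) := rfl
@[simp] theorem verticalPerm_symm_four (k : ZMod n) :
    (verticalPerm n).symm (4, k) = (0, k) := rfl

/-- Representatives of the right cosets of `U_D`. -/
def cosetRep : Fin 5 → F2 := ![1, xg, xg ^ 2, yg, yg ^ 2]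

theorem cosetRep_mul_mul_inv_mem (g : F2) (p : Square n) :
    cosetRep (monodromy n g p).1 * g * (cosetRep p.1)⁻¹ ∈ UD := by
  have inv_step : ∀ g : F2,
      (∀ p : Square n, cosetRep (monodromy n g p).1 * g * (cosetRep p.1)⁻¹ ∈ UD) →
      ∀ p : Square n, cosetRep (monodromy n g⁻¹ p).1 * g⁻¹ * (cosetRep p.1)⁻¹ ∈ UD := by
    intro g hg p
    have := inv_mem (hg (monodromy n g⁻¹ p))
    rw [← Equiv.Perm.mul_apply, ← map_mul, mul_inv_cancel, map_one, Equiv.Perm.one_apply] at this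
    simpa [mul_assoc] using this
  have mem : ∀ g ∈ ({xg ^ 3, xg * yg * (xg ^ 2)⁻¹, xg ^ 2 * yg * xg⁻¹, yg * xg * yg⁻¹,
    yg ^ 2 * xg * (yg ^ 2)⁻¹, yg ^ 3} : Set F2), g ∈ UD := fun g hg =>
      Subgroup.subset_closure hg
  have hx : ∀ p : Square n, cosetRep (monodromy n xg p).1 * xg * (cosetRep p.1)⁻¹ ∈ UD := by
    rintro ⟨i, k⟩
    fin_cases i <;> simp [cosetRep, mul_assoc]
    · exact mem _ (by simp [pow_succ, mul_assoc])
    · simp [pow_two]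
    · exact mem _ (by simp [pow_succ, mul_assoc])
    · exact mem _ (by simp [pow_succ, mul_assoc])
  have hy : ∀ p : Square n, cosetRep (monodromy n yg p).1 * yg * (cosetRep p.1)⁻¹ ∈ UD := by
    rintro ⟨i, k⟩
    fin_cases i <;> simp [cosetRep, mul_assoc]
    · exact mem _ (by simp [pow_succ, mul_assoc])
    · exact mem _ (by simp [pow_succ, mul_assoc])
    · exact mem _ (by simp [pow_succ, mul_assoc])
    · simp [pow_two]
  induction g using FreeGroup.induction_on generalizing p with
  | C1 => simp
  | of i => fin_cases i <;> [exact hx p; exact hy p]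
  | inv_of i ih => exact inv_step _ ih p
  | mul g h ihg ihh =>
    have := mul_mem (ihg (monodromy n h p)) (ihh p)
    rw [map_mul, Equiv.Perm.mul_apply]
    simpa [mul_assoc] using this

theorem horizontalPerm_zpow_three_mul (m : ℤ) (p : Square n) :
    (horizontalPerm n ^ (3 * m)) p = if p.1 < 3 then (p.1, p.2 - m) else p := by
  have h3 : ∀ p : Square n, (horizontalPerm n ^ (3 : ℤ)) p =
      if p.1 < 3 then (p.1, p.2 - 1) else p := by
    rintro ⟨i, k⟩
    fin_cases i <;> simp [pow_succ]
  have h3' : ∀ p : Square n, ((horizontalPerm n ^ (3 : ℤ))⁻¹) p =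
      if p.1 < 3 then (p.1, p.2 + 1) else p := by
    intro p
    rw [Equiv.Perm.inv_eq_iff_eq, h3]
    by_cases h : p.1 < 3 <;> simp [h]
  rw [zpow_mul]
  induction m using Int.induction_on generalizing p with
  | zero => simp
  | succ m ih =>
    rw [zpow_add_one, Equiv.Perm.mul_apply, ih, h3]
    by_cases h : p.1 < 3
    · simp [h]; ring
    · simp [h]
  | pred m ih =>
    rw [zpow_sub_one, Equiv.Perm.mul_apply, ih, h3']
    by_cases h : p.1 < 3
    · simp [h]; ring
    · simp [h]

theorem horizontalPerm_zpow_eq_one {s : ℤ} (hs : 3 * (n : ℤ) ∣ s) :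
    horizontalPerm n ^ s = 1 := by
  obtain ⟨m, rfl⟩ := hs
  ext1 p
  rw [mul_assoc, horizontalPerm_zpow_three_mul]
  split_ifs <;> simp

theorem dvd_of_horizontalPerm_zpow_apply {s : ℤ} {k : ZMod n}
    (h : (horizontalPerm n ^ s) (0, k) = (0, k)) : 3 * (n : ℤ) ∣ s := by
  have hs := Int.emod_add_mul_ediv s 3
  have h0 := Int.emod_nonneg s (show (3 : ℤ) ≠ 0 by norm_num)
  have h1 := Int.emod_lt_of_pos s (show (0 : ℤ) < 3 by norm_num)
  generalize s % 3 = r at hs h0 h1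
  generalize s / 3 = m at hs
  subst hs
  rw [zpow_add, Equiv.Perm.mul_apply, horizontalPerm_zpow_three_mul] at h
  interval_cases r
  · simp at h
    rw [zero_add]
    exact mul_dvd_mul_left 3 ((ZMod.intCast_zmod_eq_zero_iff_dvd m n).mp h)
  · simp at h
  · simp [pow_two] at h

theorem monodromy_apply_of_mem_UD (α : UD →* Multiplicative ℤ)
    (hα1 : ∀ hm : xg ^ 3 ∈ UD, α ⟨xg ^ 3, hm⟩ = Multiplicative.ofAdd 1)
    (hα2 : ∀ hm : xg * yg * (xg ^ 2)⁻¹ ∈ UD, α ⟨xg * yg * (xg ^ 2)⁻¹, hm⟩ = 1)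
    (hα3 : ∀ hm : xg ^ 2 * yg * xg⁻¹ ∈ UD, α ⟨xg ^ 2 * yg * xg⁻¹, hm⟩ = 1)
    (hα4 : ∀ hm : yg * xg * yg⁻¹ ∈ UD, α ⟨yg * xg * yg⁻¹, hm⟩ = 1)
    (hα5 : ∀ hm : yg ^ 2 * xg * (yg ^ 2)⁻¹ ∈ UD, α ⟨yg ^ 2 * xg * (yg ^ 2)⁻¹, hm⟩ = 1)
    (hα6 : ∀ hm : yg ^ 3 ∈ UD, α ⟨yg ^ 3, hm⟩ = 1)
    (u : F2) (hu : u ∈ UD) (k : ZMod n) :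
    monodromy n u (0, k) = (0, k - ((α ⟨u, hu⟩).toAdd : ZMod n)) := by
  induction hu using Subgroup.closure_induction generalizing k with
  | mem u hu =>
    have hmem : u ∈ UD := Subgroup.subset_closure hu
    change _ = (0, k - ((α ⟨u, hmem⟩).toAdd : ZMod n))
    rcases hu with rfl | rfl | rfl | rfl | rfl | rfl
    · rw [hα1]; simp [pow_succ]
    · rw [hα2]; simp [pow_succ]
    · rw [hα3]; simp [pow_succ]
    · rw [hα4]; simp
    · rw [hα5]; simp [pow_succ]
    · rw [hα6]; simp [pow_succ]
  | one =>
    have : α ⟨1, one_mem UD⟩ = 1 := map_one α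
    simp [this]
  | mul u v hu hv ihu ihv =>
    have : α ⟨u * v, mul_mem hu hv⟩ = α ⟨u, hu⟩ * α ⟨v, hv⟩ := map_mul α ⟨u, hu⟩ ⟨v, hv⟩
    rw [map_mul, Equiv.Perm.mul_apply, ihv, ihu, this, toAdd_mul]
    push_cast
    ring_nf
  | inv u hu ih =>
    have : α ⟨u⁻¹, inv_mem hu⟩ = (α ⟨u, hu⟩)⁻¹ := map_inv α ⟨u, hu⟩
    rw [map_inv, Equiv.Perm.inv_eq_iff_eq, ih, this, toAdd_inv]
    simp

theorem mem_Hgrp_iff_of_monodromy (α : UD →* Multiplicative ℤ)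
    (h : ∀ (u : F2) (hu : u ∈ UD) (k : ZMod n),
      monodromy n u (0, k) = (0, k - ((α ⟨u, hu⟩).toAdd : ZMod n))) (g : F2) :
    g ∈ Hgrp α n ↔ monodromy n g (0, 0) = (0, 0) := by
  constructor
  · rintro ⟨⟨u, hu⟩, hα, rfl⟩
    have hα : (n : ℤ) ∣ (α ⟨u, hu⟩).toAdd := hα
    simp [h u hu, (ZMod.intCast_zmod_eq_zero_iff_dvd _ n).mpr hα]
  · intro hg
    have hu : g ∈ UD := by
      simpa [hg, cosetRep] using cosetRep_mul_mul_inv_mem g ((0, 0) : Square n)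
    have hα : (n : ℤ) ∣ (α ⟨g, hu⟩).toAdd := by
      rw [h g hu] at hg
      exact (ZMod.intCast_zmod_eq_zero_iff_dvd _ n).mp (by simpa using hg)
    exact ⟨⟨g, hu⟩, hα, rfl⟩

theorem horizontalPerm_apply_eq_iff (p : Square n) :
    horizontalPerm n p = p ↔ p.1 = 3 ∨ p.1 = 4 := by
  obtain ⟨i, k⟩ := p
  fin_cases i <;> simp

theorem monodromy_shearAut {s : ℤ} (hs : 3 * (n : ℤ) ∣ s) (g : F2) :
    monodromy n (shearAut s g) = monodromy n g := by
  have : (monodromy n).comp (shearAut s).toMonoidHom = monodromy n :=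
    F2.hom_ext (by simp) (by simp [horizontalPerm_zpow_eq_one hs])
  exact DFunLike.congr_fun this g

theorem dvd_of_shearAut_fixes {s : ℤ} {q : Square n}
    (hx : horizontalPerm n q ≠ q)
    (h4 : monodromy n (shearAut s (yg * xg * yg⁻¹)) q = q)
    (h2 : monodromy n (shearAut s (xg * yg * (xg ^ 2)⁻¹)) q = q) : 3 * (n : ℤ) ∣ s := by
  obtain ⟨r, rfl⟩ : ∃ r, (horizontalPerm n ^ s) r = q := (horizontalPerm n ^ s).surjective q
  have hr : horizontalPerm n r ≠ r := by
    intro h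
    apply hx
    rw [← Equiv.Perm.mul_apply, ← zpow_one_add, add_comm, zpow_add_one, Equiv.Perm.mul_apply, h]
  have hz : horizontalPerm n ((verticalPerm n).symm r) = (verticalPerm n).symm r := by
    have : monodromy n (shearAut s (yg * xg * yg⁻¹)) =
        horizontalPerm n ^ s *
          (verticalPerm n * (horizontalPerm n * (verticalPerm n)⁻¹)) *
            (horizontalPerm n ^ s)⁻¹ := by
      simp [mul_assoc]
    rw [this] at h4
    simp only [Equiv.Perm.mul_apply, Equiv.Perm.inv_def, Equiv.symm_apply_apply,
      EmbeddingLike.apply_eq_iff_eq] at h4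
    rwa [Equiv.eq_symm_apply]
  obtain ⟨k, rfl⟩ : ∃ k, r = (0, k) := by
    obtain ⟨i, k⟩ := r
    rw [horizontalPerm_apply_eq_iff] at hz
    fin_cases i <;> simp at hz hr ⊢
  have h2 : (horizontalPerm n ^ s) (0, k) = (0, k) := by
    have : monodromy n (shearAut s (xg * yg * (xg ^ 2)⁻¹)) =
        horizontalPerm n ^ s * (horizontalPerm n * (verticalPerm n *
          ((horizontalPerm n)⁻¹ * (horizontalPerm n)⁻¹))) := by
      simp only [pow_two, map_mul, map_inv, mul_inv_rev, mul_assoc, shearAut_xg, shearAut_yg,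
        map_zpow, monodromy_xg, monodromy_yg]
      rw [← mul_assoc, (Commute.self_zpow (horizontalPerm n) s).eq, mul_assoc]
    rw [this] at h2
    simpa only [Equiv.Perm.mul_apply, Equiv.Perm.inv_def, EmbeddingLike.apply_eq_iff_eq,
      ← Equiv.eq_symm_apply, Equiv.symm_symm, Equiv.symm_apply_eq, horizontalPerm_symm_zero,
      verticalPerm_symm_one, horizontalPerm_two, horizontalPerm_one] using h2
  exact dvd_of_horizontalPerm_zpow_apply h2

end Monodromy

theorem map_Hgrp_shearAut {H : Subgroup F2} {n : ℕ}
    (hH : ∀ g, g ∈ H ↔ monodromy n g (0, 0) = (0, 0)) {s : ℤ} (hs : 3 * (n : ℤ) ∣ s) :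
    H.map (shearAut s).toMonoidHom = H := by
  ext g
  rw [Subgroup.mem_map_equiv, hH, hH, ← monodromy_shearAut hs ((shearAut s).symm g),
    MulEquiv.apply_symm_apply]

theorem exists_eq_conj_mul {γ δ : MulAut F2} (h : autMat γ = autMat δ) :
    ∃ c, γ = MulAut.conj c * δ := by
  obtain ⟨c, hc⟩ := exists_conj_eq (γ := γ * δ⁻¹) (by
    rw [autMat_mul, h, ← autMat_mul, mul_inv_cancel, autMat_one])
  exact ⟨c, by rw [← hc, inv_mul_cancel_right]⟩

theorem dvd_of_map_eq {H : Subgroup F2} {n : ℕ}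
    (hH : ∀ g, g ∈ H ↔ monodromy n g (0, 0) = (0, 0)) {s : ℤ} {γ : MulAut F2}
    (hγ : autMat γ = !![1, s; 0, 1]) (hmap : H.map γ.toMonoidHom = H) :
    3 * (n : ℤ) ∣ s := by
  obtain ⟨c, rfl⟩ := exists_eq_conj_mul (hγ.trans (autMat_shearAut s).symm)
  have key : ∀ g, monodromy n g (0, 0) = (0, 0) ↔
      monodromy n (shearAut s g) (monodromy n c⁻¹ (0, 0)) = monodromy n c⁻¹ (0, 0) := by
    intro g
    have hg : g ∈ H ↔ (MulAut.conj c * shearAut s) g ∈ H := by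
      conv_rhs => rw [← hmap]
      exact (Subgroup.mem_map_iff_mem (MulAut.conj c * shearAut s).injective).symm
    rw [hH, hH] at hg
    rw [hg, map_inv, Equiv.Perm.eq_inv_iff_eq]
    simp
  refine dvd_of_shearAut_fixes (q := monodromy n c⁻¹ (0, 0)) (fun h => ?_)
    ((key _).mp (by simp)) ((key _).mp (by simp [pow_two]))
  have := (key xg).mpr (by simpa only [shearAut_xg, monodromy_xg] using h)
  simp at this

/-- For the subgroups `Hₙ` built from `U_D` as in Setting A: for every `n ≥ 1` and every
integer `s`, the matrix `[[1,s],[0,1]]` lies in `Γ(Hₙ)` iff `3n ∣ s`. -/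
theorem UD_parabolic_mem_veech_Hn_iff
    (α : UD →* Multiplicative ℤ)
    (hα1 : ∀ hm : xg ^ 3 ∈ UD, α ⟨xg ^ 3, hm⟩ = Multiplicative.ofAdd 1)
    (hα2 : ∀ hm : xg * yg * (xg ^ 2)⁻¹ ∈ UD, α ⟨xg * yg * (xg ^ 2)⁻¹, hm⟩ = 1)
    (hα3 : ∀ hm : xg ^ 2 * yg * xg⁻¹ ∈ UD, α ⟨xg ^ 2 * yg * xg⁻¹, hm⟩ = 1)
    (hα4 : ∀ hm : yg * xg * yg⁻¹ ∈ UD, α ⟨yg * xg * yg⁻¹, hm⟩ = 1)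
    (hα5 : ∀ hm : yg ^ 2 * xg * (yg ^ 2)⁻¹ ∈ UD, α ⟨yg ^ 2 * xg * (yg ^ 2)⁻¹, hm⟩ = 1)
    (hα6 : ∀ hm : yg ^ 3 ∈ UD, α ⟨yg ^ 3, hm⟩ = 1)
    : ∀ n : ℕ, 1 ≤ n → ∀ s : ℤ,
      ((⟨!![1, s; 0, 1], by simp [Matrix.det_fin_two_of]⟩ : SL2Z) ∈
        VeechGroup (Hgrp α n)) ↔ (3 * (n : ℤ)) ∣ s := by
  intro n _ s
  have hH := mem_Hgrp_iff_of_monodromy (n := n) α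
    (monodromy_apply_of_mem_UD α hα1 hα2 hα3 hα4 hα5 hα6)
  constructor
  · rintro ⟨γ, ⟨-, hmap⟩, hγ⟩
    exact dvd_of_map_eq hH hγ.symm hmap
  · intro hs
    refine ⟨shearAut s, ⟨?_, map_Hgrp_shearAut hH hs⟩, (autMat_shearAut s).symm⟩
    simp [autMat_shearAut]
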